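/- Let D, M be positive natural numbers, let W_B, W_O : Matrix (Fin D) (Fin D) ℝ each satisfy the row-sum constraint (every row sums to 1), and let V : Fin M → Matrix (Fin D) (Fin 3) ℝ. For each i : Fin M and channel d : Fin D define the score h(V)(i, d) = ∑ j, ((V i − W_O * (V i)) d j) * ((W_B * (V i) − W_O * (V i)) d j). Suppose for a channel d there is a strict unique maximizer i* : Fin M, i.e. ∀ i' ≠ i*, h(V)(i', d) < h(V)(i*, d). Then for every s : ℝ with 0 < s, every R : Matrix (Fin 3) (Fin 3) ℝ with R * Rᵀ = 1 and det R = 1, and every t : Fin 3 → ℝ, the index i* is also the strict unique maximizer of h(fun k => s • ((V k) * R) + T_D(t))(·, d); consequently the d-th output row of VN-Max on the transformed family equals the d-th row of s • ((V i*) * R) + T_D(t). -/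

import Mathlib

open Matrix

/-- The matrix with every row equal to `t`. -/
def Tmat (D : ℕ) (t : Fin 3 → ℝ) : Matrix (Fin D) (Fin 3) ℝ :=
  Matrix.of fun _ j => t j

/-- VN-Max score: channel-wise alignment of centered features with centered directions. -/
def vnMaxScore (D M : ℕ) (WB WO : Matrix (Fin D) (Fin D) ℝ)
    (V : Fin M → Matrix (Fin D) (Fin 3) ℝ) (i : Fin M) (d : Fin D) : ℝ :=
  ∑ j, ((V i - WO * V i) d j) * ((WB * V i - WO * V i) d j)

theorem mul_Tmat {D : ℕ} {W : Matrix (Fin D) (Fin D) ℝ} (hW : ∀ i, ∑ j, W i j = 1)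
    (t : Fin 3 → ℝ) : W * Tmat D t = Tmat D t := by
  ext i j
  simp [Matrix.mul_apply, Tmat, ← Finset.sum_mul, hW]

theorem Matrix.mul_row_dotProduct_mul_row {m n : Type*} [Fintype n] [DecidableEq n]
    {R : Matrix n n ℝ} (hR : R * Rᵀ = 1) (A B : Matrix m n ℝ) (i : m) :
    (A * R) i ⬝ᵥ (B * R) i = A i ⬝ᵥ B i := by
  have h : (A * R) * (B * R)ᵀ = A * Bᵀ := by
    rw [Matrix.transpose_mul, Matrix.mul_assoc, ← Matrix.mul_assoc R, hR, Matrix.one_mul]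
  exact congrFun (congrFun h i) i

/-- A similarity transform rescales every VN-Max score by the square of its scale factor. -/
theorem vnMaxScore_similarity {D M : ℕ} {WB WO : Matrix (Fin D) (Fin D) ℝ}
    (hWB : ∀ i, ∑ j, WB i j = 1) (hWO : ∀ i, ∑ j, WO i j = 1)
    (V : Fin M → Matrix (Fin D) (Fin 3) ℝ) (s : ℝ)
    {R : Matrix (Fin 3) (Fin 3) ℝ} (hR : R * Rᵀ = 1) (t : Fin 3 → ℝ) (i : Fin M) (d : Fin D) :
    vnMaxScore D M WB WO (fun k => s • (V k * R) + Tmat D t) i d =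
      s ^ 2 * vnMaxScore D M WB WO V i d := by
  have hO : s • (V i * R) + Tmat D t - WO * (s • (V i * R) + Tmat D t) =
      s • ((V i - WO * V i) * R) := by
    rw [Matrix.mul_add, mul_Tmat hWO, Matrix.mul_smul, Matrix.sub_mul, smul_sub,
      Matrix.mul_assoc, add_sub_add_right_eq_sub]
  have hB : WB * (s • (V i * R) + Tmat D t) - WO * (s • (V i * R) + Tmat D t) =
      s • ((WB * V i - WO * V i) * R) := by
    rw [Matrix.mul_add, Matrix.mul_add, mul_Tmat hWO, mul_Tmat hWB, Matrix.mul_smul,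
      Matrix.mul_smul, Matrix.sub_mul, smul_sub, Matrix.mul_assoc, Matrix.mul_assoc,
      add_sub_add_right_eq_sub]
  have h := Matrix.mul_row_dotProduct_mul_row hR (V i - WO * V i) (WB * V i - WO * V i) d
  unfold dotProduct at h
  simp only [vnMaxScore]
  rw [hO, hB, ← h, Finset.mul_sum]
  refine Finset.sum_congr rfl fun j _ => ?_
  simp only [Matrix.smul_apply, smul_eq_mul]
  ring

theorem vnMax_strict_maximizer_sim3
    (D M : ℕ) (hD : 0 < D) (hM : 0 < M)
    (WB WO : Matrix (Fin D) (Fin D) ℝ)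
    (hWB : ∀ i, ∑ j, WB i j = 1) (hWO : ∀ i, ∑ j, WO i j = 1)
    (V : Fin M → Matrix (Fin D) (Fin 3) ℝ)
    (d : Fin D) (istar : Fin M)
    (hmax : ∀ i' ≠ istar, vnMaxScore D M WB WO V i' d < vnMaxScore D M WB WO V istar d)
    (s : ℝ) (hs : 0 < s)
    (R : Matrix (Fin 3) (Fin 3) ℝ) (hR : R * Rᵀ = 1) (hdet : R.det = 1)
    (t : Fin 3 → ℝ) :
    (∀ i' ≠ istar,
        vnMaxScore D M WB WO (fun k => s • (V k * R) + Tmat D t) i' d <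
          vnMaxScore D M WB WO (fun k => s • (V k * R) + Tmat D t) istar d) ∧
    (∀ i : Fin M,
        (∀ i', vnMaxScore D M WB WO (fun k => s • (V k * R) + Tmat D t) i' d ≤
            vnMaxScore D M WB WO (fun k => s • (V k * R) + Tmat D t) i d) →
        (s • (V i * R) + Tmat D t) d = (s • (V istar * R) + Tmat D t) d) := by
  have hstrict : ∀ i' ≠ istar,
      vnMaxScore D M WB WO (fun k => s • (V k * R) + Tmat D t) i' d <
        vnMaxScore D M WB WO (fun k => s • (V k * R) + Tmat D t) istar d := by
    intro i' hi'
    rw [vnMaxScore_similarity hWB hWO V s hR, vnMaxScore_similarity hWB hWO V s hR]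
    exact mul_lt_mul_of_pos_left (hmax i' hi') (pow_pos hs 2)
  refine ⟨hstrict, fun i hi => ?_⟩
  have : i = istar := by
    by_contra hne
    exact (hstrict i hne).not_ge (hi istar)
  rw [this]
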